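/- Let γ be the standard Gaussian measure on ℝ and let m be an even positive integer. Then for every smooth compactly supported function f : ℝ → ℝ, ∫_ℝ Σ_{k=0}^{m} ((−1)^k / k!) · (f^{(k)}(x))² dγ(x) ≥ (∫_ℝ f dγ)². Equivalently, ∫_ℝ f² dγ − (∫_ℝ f dγ)² ≤ Σ_{k=1}^{m} ((−1)^{k+1}/k!) ∫_ℝ (f^{(k)})² dγ (the Houdré–Kagan upper bound in dimension one). -/

import Mathlib

open MeasureTheory Real ProbabilityTheory

lemma hasDerivAt_gaussianPDFReal_std (x : ℝ) :
    HasDerivAt (gaussianPDFReal 0 1) (-(x * gaussianPDFReal 0 1 x)) x := by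
  rw [gaussianPDFReal_def]
  have h : HasDerivAt (fun x : ℝ ↦ -(x - 0) ^ 2 / (2 * ((1 : NNReal) : ℝ))) (-x) x := by
    convert! (((hasDerivAt_id x).sub_const 0).pow 2).neg.div_const (2 * ((1 : NNReal) : ℝ)) using 1
    simp only [NNReal.coe_one, id, Nat.cast_ofNat]
    ring
  convert! h.exp.const_mul (√(2 * π * ((1 : NNReal) : ℝ)))⁻¹ using 1
  ring

lemma integrable_std_gaussian_iff {g : ℝ → ℝ} :
    Integrable g (gaussianReal 0 1) ↔ Integrable (fun x ↦ g x * gaussianPDFReal 0 1 x) := by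
  rw [gaussianReal_of_var_ne_zero 0 one_ne_zero,
    integrable_withDensity_iff (measurable_gaussianPDF 0 1) (by simp [gaussianPDF_lt_top])]
  simp [toReal_gaussianPDF]

lemma integrable_id_std_gaussian : Integrable (fun x : ℝ ↦ x) (gaussianReal 0 1) :=
  memLp_one_iff_integrable.1 (memLp_id_gaussianReal' 1 (by simp))

/-- Gaussian integration by parts (Stein's identity) for bounded functions. -/
lemma integral_id_mul_std_gaussian {h h' : ℝ → ℝ} (hh : ∀ x, HasDerivAt h (h' x) x)
    (hh'm : Measurable h') {C C' : ℝ} (hC : ∀ x, ‖h x‖ ≤ C) (hC' : ∀ x, ‖h' x‖ ≤ C') :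
    ∫ x, x * h x ∂(gaussianReal 0 1) = ∫ x, h' x ∂(gaussianReal 0 1) := by
  have hcont : Continuous h := continuous_iff_continuousAt.2 fun x ↦ (hh x).continuousAt
  have i0 : Integrable h (gaussianReal 0 1) :=
    .of_bound hcont.aestronglyMeasurable C (.of_forall hC)
  have i1 : Integrable h' (gaussianReal 0 1) :=
    .of_bound hh'm.aestronglyMeasurable C' (.of_forall hC')
  have i2 : Integrable (fun x ↦ x * h x) (gaussianReal 0 1) :=
    integrable_id_std_gaussian.mul_bdd hcont.aestronglyMeasurable (.of_forall hC)
  rw [integrable_std_gaussian_iff] at i0 i1 i2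
  have key := integral_mul_deriv_eq_deriv_mul_of_integrable (u := h) (u' := h')
    (v := gaussianPDFReal 0 1) (v' := fun x ↦ -(x * gaussianPDFReal 0 1 x))
    (fun x _ ↦ hh x) (fun x _ ↦ hasDerivAt_gaussianPDFReal_std x)
    (by convert! i2.neg using 1; ext x; simp; ring) i1 i0
  rw [integral_gaussianReal_eq_integral_smul one_ne_zero,
    integral_gaussianReal_eq_integral_smul one_ne_zero]
  simp only [smul_eq_mul]
  have e : ∀ x, h x * -(x * gaussianPDFReal 0 1 x) = -(gaussianPDFReal 0 1 x * (x * h x)) := by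
    intro x; ring
  simp only [e, integral_neg, neg_inj] at key
  rw [key]
  simp only [mul_comm]

section Product
variable {E : Type*} [MeasurableSpace E] (ν : Measure E) [IsProbabilityMeasure ν]

lemma integral_fst_mul_std_gaussian {Φ Φ' : ℝ × E → ℝ} (hΦ : Measurable Φ) (hΦ' : Measurable Φ')
    (hd : ∀ x y, HasDerivAt (fun x ↦ Φ (x, y)) (Φ' (x, y)) x)
    {C C' : ℝ} (hC : ∀ p, ‖Φ p‖ ≤ C) (hC' : ∀ p, ‖Φ' p‖ ≤ C') :
    ∫ p, p.1 * Φ p ∂((gaussianReal 0 1).prod ν) = ∫ p, Φ' p ∂((gaussianReal 0 1).prod ν) := by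
  rw [integral_prod_symm, integral_prod_symm]
  · congr 1 with y
    exact integral_id_mul_std_gaussian (fun x ↦ hd x y) (hΦ'.comp (by fun_prop))
      (fun x ↦ hC _) (fun x ↦ hC' _)
  · exact .of_bound hΦ'.aestronglyMeasurable C' (.of_forall hC')
  · exact (integrable_id_std_gaussian.comp_fst ν).mul_bdd hΦ.aestronglyMeasurable (.of_forall hC)

lemma integral_snd_mul_std_gaussian {Φ Φ' : E × ℝ → ℝ} (hΦ : Measurable Φ) (hΦ' : Measurable Φ')
    (hd : ∀ y x, HasDerivAt (fun x ↦ Φ (y, x)) (Φ' (y, x)) x)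
    {C C' : ℝ} (hC : ∀ p, ‖Φ p‖ ≤ C) (hC' : ∀ p, ‖Φ' p‖ ≤ C') :
    ∫ p, p.2 * Φ p ∂(ν.prod (gaussianReal 0 1)) = ∫ p, Φ' p ∂(ν.prod (gaussianReal 0 1)) := by
  rw [← integral_prod_swap, ← integral_prod_swap Φ']
  exact integral_fst_mul_std_gaussian ν (hΦ.comp measurable_swap) (hΦ'.comp measurable_swap)
    (fun x y ↦ hd y x) (fun p ↦ hC _) (fun p ↦ hC' _)

end Product

/-- Smooth compactly supported functions on the line. -/
def IsTestFunction (g : ℝ → ℝ) : Prop := ContDiff ℝ (⊤ : ℕ∞) g ∧ HasCompactSupport g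

namespace IsTestFunction
variable {g : ℝ → ℝ}

protected lemma deriv (hg : IsTestFunction g) : IsTestFunction (deriv g) :=
  ⟨(contDiff_infty_iff_deriv.1 hg.1).2, hg.2.deriv⟩

protected lemma iteratedDeriv (hg : IsTestFunction g) (k : ℕ) : IsTestFunction (iteratedDeriv k g) := by
  induction k with
  | zero => simpa using hg
  | succ k ih => rw [iteratedDeriv_succ]; exact ih.deriv

@[fun_prop]
protected lemma continuous (hg : IsTestFunction g) : Continuous g := hg.1.continuous

protected lemma hasDerivAt (hg : IsTestFunction g) (x : ℝ) : HasDerivAt g (_root_.deriv g x) x :=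
  ((contDiff_infty_iff_deriv.1 hg.1).1 x).hasDerivAt

lemma exists_bound (hg : IsTestFunction g) : ∃ C, 0 ≤ C ∧ ∀ x, ‖g x‖ ≤ C := by
  obtain ⟨C, hC⟩ := hg.2.exists_bound_of_continuous hg.continuous
  exact ⟨C, (norm_nonneg _).trans (hC 0), hC⟩

end IsTestFunction

/-- The product of three standard Gaussian measures. -/
noncomputable def gaussianTriple : Measure (ℝ × ℝ × ℝ) :=
  (gaussianReal 0 1).prod ((gaussianReal 0 1).prod (gaussianReal 0 1))

instance : IsProbabilityMeasure gaussianTriple := by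
  unfold gaussianTriple; infer_instance

/-- The product of the values of `a` and `b` at two conditionally independent rotations of the
first coordinate. -/
noncomputable def rotProd (a b : ℝ → ℝ) (θ : ℝ) (p : ℝ × ℝ × ℝ) : ℝ :=
  a (cos θ * p.1 + sin θ * p.2.1) * b (cos θ * p.1 + sin θ * p.2.2)

section RotProd
variable {a b : ℝ → ℝ}

lemma continuous_rotProd (ha : IsTestFunction a) (hb : IsTestFunction b) (θ : ℝ) :
    Continuous (rotProd a b θ) := by
  have := ha.continuous
  have := hb.continuous
  unfold rotProd
  fun_prop

lemma exists_bound_rotProd (ha : IsTestFunction a) (hb : IsTestFunction b) :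
    ∃ C, 0 ≤ C ∧ ∀ θ p, ‖rotProd a b θ p‖ ≤ C := by
  obtain ⟨A, hA0, hA⟩ := ha.exists_bound
  obtain ⟨B, hB0, hB⟩ := hb.exists_bound
  refine ⟨A * B, by positivity, fun θ p ↦ ?_⟩
  rw [rotProd, norm_mul]
  exact mul_le_mul (hA _) (hB _) (norm_nonneg _) hA0

lemma integrable_rotProd (ha : IsTestFunction a) (hb : IsTestFunction b) (θ : ℝ) :
    Integrable (rotProd a b θ) gaussianTriple := by
  obtain ⟨C, -, hC⟩ := exists_bound_rotProd ha hb
  exact .of_bound (continuous_rotProd ha hb θ).aestronglyMeasurable C (.of_forall (hC θ))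

lemma integrable_fst_gaussianTriple : Integrable (fun p ↦ p.1) gaussianTriple :=
  integrable_id_std_gaussian.comp_fst _

lemma integrable_snd_fst_gaussianTriple : Integrable (fun p ↦ p.2.1) gaussianTriple :=
  (integrable_id_std_gaussian.comp_fst (gaussianReal 0 1)).comp_snd (gaussianReal 0 1)

lemma integrable_snd_snd_gaussianTriple : Integrable (fun p ↦ p.2.2) gaussianTriple :=
  (integrable_id_std_gaussian.comp_snd (gaussianReal 0 1)).comp_snd (gaussianReal 0 1)

lemma integrable_mul_rotProd {φ : ℝ × ℝ × ℝ → ℝ} (hφ : Integrable φ gaussianTriple)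
    (ha : IsTestFunction a) (hb : IsTestFunction b) (θ : ℝ) :
    Integrable (fun p ↦ φ p * rotProd a b θ p) gaussianTriple := by
  obtain ⟨C, -, hC⟩ := exists_bound_rotProd ha hb
  exact hφ.mul_bdd (continuous_rotProd ha hb θ).aestronglyMeasurable (.of_forall (hC θ))

lemma integral_fst_mul_rotProd (ha : IsTestFunction a) (hb : IsTestFunction b) (θ : ℝ) :
    ∫ p, p.1 * rotProd a b θ p ∂gaussianTriple =
      cos θ * (∫ p, rotProd (deriv a) b θ p ∂gaussianTriple +
        ∫ p, rotProd a (deriv b) θ p ∂gaussianTriple) := by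
  obtain ⟨C, -, hC⟩ := exists_bound_rotProd ha hb
  obtain ⟨C₁, -, hC₁⟩ := exists_bound_rotProd ha.deriv hb
  obtain ⟨C₂, -, hC₂⟩ := exists_bound_rotProd ha hb.deriv
  have c₁ := continuous_rotProd ha.deriv hb θ
  have c₂ := continuous_rotProd ha hb.deriv θ
  rw [← integral_add (integrable_rotProd ha.deriv hb θ) (integrable_rotProd ha hb.deriv θ),
    ← integral_const_mul]
  refine integral_fst_mul_std_gaussian _ (continuous_rotProd ha hb θ).measurable
    (Φ' := fun p ↦ cos θ * (rotProd (deriv a) b θ p + rotProd a (deriv b) θ p))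
    (by fun_prop) (fun x y ↦ ?_) (hC θ) (C' := |cos θ| * (C₁ + C₂)) (fun p ↦ ?_)
  · have hl : ∀ y : ℝ, HasDerivAt (fun x ↦ cos θ * x + sin θ * y) (cos θ) x := fun y ↦ by
      simpa using ((hasDerivAt_id x).const_mul (cos θ)).add_const (sin θ * y)
    convert! ((ha.hasDerivAt _).comp x (hl y.1)).mul ((hb.hasDerivAt _).comp x (hl y.2)) using 1
    simp only [rotProd, Function.comp]
    ring
  · rw [norm_mul, norm_eq_abs (cos θ)]
    gcongr
    exact norm_add_le_of_le (hC₁ θ p) (hC₂ θ p)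

lemma integral_snd_fst_mul_rotProd (ha : IsTestFunction a) (hb : IsTestFunction b) (θ : ℝ) :
    ∫ p, p.2.1 * rotProd a b θ p ∂gaussianTriple =
      sin θ * ∫ p, rotProd (deriv a) b θ p ∂gaussianTriple := by
  obtain ⟨C, -, hC⟩ := exists_bound_rotProd ha hb
  obtain ⟨C₁, -, hC₁⟩ := exists_bound_rotProd ha.deriv hb
  have c₀ := continuous_rotProd ha hb θ
  have c₁ := continuous_rotProd ha.deriv hb θ
  rw [← integral_const_mul]
  have i₀ := integrable_mul_rotProd integrable_snd_fst_gaussianTriple ha hb θ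
  have i₁ := (integrable_rotProd ha.deriv hb θ).const_mul (sin θ)
  unfold gaussianTriple at i₀ i₁ ⊢
  rw [integral_prod _ i₀, integral_prod _ i₁]
  congr 1 with u
  refine integral_fst_mul_std_gaussian _ (Φ := fun q ↦ rotProd a b θ (u, q)) (by fun_prop)
    (Φ' := fun q ↦ sin θ * rotProd (deriv a) b θ (u, q))
    (by fun_prop) (fun x y ↦ ?_) (fun q ↦ hC θ _) (C' := |sin θ| * C₁) (fun q ↦ ?_)
  · have hl : HasDerivAt (fun x ↦ cos θ * u + sin θ * x) (sin θ) x := by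
      simpa using ((hasDerivAt_id x).const_mul (sin θ)).const_add (cos θ * u)
    convert! ((ha.hasDerivAt _).comp x hl).mul_const (b (cos θ * u + sin θ * y)) using 1
    simp only [rotProd]
    ring
  · rw [norm_mul, norm_eq_abs (sin θ)]
    gcongr
    exact hC₁ θ _

lemma integral_snd_snd_mul_rotProd (ha : IsTestFunction a) (hb : IsTestFunction b) (θ : ℝ) :
    ∫ p, p.2.2 * rotProd a b θ p ∂gaussianTriple =
      sin θ * ∫ p, rotProd a (deriv b) θ p ∂gaussianTriple := by
  obtain ⟨C, -, hC⟩ := exists_bound_rotProd ha hb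
  obtain ⟨C₁, -, hC₁⟩ := exists_bound_rotProd ha hb.deriv
  have c₀ := continuous_rotProd ha hb θ
  have c₁ := continuous_rotProd ha hb.deriv θ
  rw [← integral_const_mul]
  have i₀ := integrable_mul_rotProd integrable_snd_snd_gaussianTriple ha hb θ
  have i₁ := (integrable_rotProd ha hb.deriv θ).const_mul (sin θ)
  unfold gaussianTriple at i₀ i₁ ⊢
  rw [integral_prod _ i₀, integral_prod _ i₁]
  congr 1 with u
  refine integral_snd_mul_std_gaussian _ (Φ := fun q ↦ rotProd a b θ (u, q)) (by fun_prop)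
    (Φ' := fun q ↦ sin θ * rotProd a (deriv b) θ (u, q))
    (by fun_prop) (fun y x ↦ ?_) (fun q ↦ hC θ _) (C' := |sin θ| * C₁) (fun q ↦ ?_)
  · have hl : HasDerivAt (fun x ↦ cos θ * u + sin θ * x) (sin θ) x := by
      simpa using ((hasDerivAt_id x).const_mul (sin θ)).const_add (cos θ * u)
    convert! ((hb.hasDerivAt _).comp x hl).const_mul (a (cos θ * u + sin θ * y)) using 1
    simp only [rotProd]
    ring
  · rw [norm_mul, norm_eq_abs (sin θ)]
    gcongr
    exact hC₁ θ _

end RotProd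

/-- The energy `∫ (∫ g (cos θ u + sin θ v) dγ(v))² dγ(u)`, written as a triple integral. -/
noncomputable def rotEnergy (g : ℝ → ℝ) (θ : ℝ) : ℝ := ∫ p, rotProd g g θ p ∂gaussianTriple

section RotEnergy
variable {g : ℝ → ℝ}

lemma rotEnergy_eq (hg : IsTestFunction g) (θ : ℝ) : rotEnergy g θ =
    ∫ u, (∫ v, g (cos θ * u + sin θ * v) ∂(gaussianReal 0 1)) ^ 2 ∂(gaussianReal 0 1) := by
  have i := integrable_rotProd hg hg θ
  unfold rotEnergy
  unfold gaussianTriple at i ⊢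
  rw [integral_prod _ i]
  congr 1 with u
  simp only [rotProd, sq]
  exact integral_prod_mul (fun v ↦ g (cos θ * u + sin θ * v))
    (fun v ↦ g (cos θ * u + sin θ * v))

lemma rotEnergy_nonneg (hg : IsTestFunction g) (θ : ℝ) : 0 ≤ rotEnergy g θ := by
  rw [rotEnergy_eq hg]
  exact integral_nonneg fun u ↦ sq_nonneg _

lemma rotEnergy_zero (hg : IsTestFunction g) :
    rotEnergy g 0 = ∫ x, g x ^ 2 ∂(gaussianReal 0 1) := by
  simp [rotEnergy_eq hg]

lemma rotEnergy_pi_div_two (hg : IsTestFunction g) :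
    rotEnergy g (π / 2) = (∫ x, g x ∂(gaussianReal 0 1)) ^ 2 := by
  simp [rotEnergy_eq hg]

lemma hasDerivAt_rotEnergy (hg : IsTestFunction g) (θ : ℝ) :
    HasDerivAt (rotEnergy g) (-(2 * sin θ * cos θ * rotEnergy (deriv g) θ)) θ := by
  have hg' := hg.deriv
  obtain ⟨C₁, -, hC₁⟩ := exists_bound_rotProd hg' hg
  obtain ⟨C₂, -, hC₂⟩ := exists_bound_rotProd hg hg'
  let F' : ℝ → ℝ × ℝ × ℝ → ℝ := fun θ p ↦
    (-sin θ * p.1 + cos θ * p.2.1) * rotProd (deriv g) g θ p +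
      (-sin θ * p.1 + cos θ * p.2.2) * rotProd g (deriv g) θ p
  have i1 := integrable_fst_gaussianTriple
  have i2 := integrable_snd_fst_gaussianTriple
  have i3 := integrable_snd_snd_gaussianTriple
  have hlin : ∀ (t x y : ℝ), ‖-sin t * x + cos t * y‖ ≤ ‖x‖ + ‖y‖ := fun t x y ↦ by
    refine norm_add_le_of_le ?_ ?_
    · rw [norm_mul, norm_neg]
      exact mul_le_of_le_one_left (norm_nonneg _) (abs_sin_le_one t)
    · rw [norm_mul]
      exact mul_le_of_le_one_left (norm_nonneg _) (abs_cos_le_one t)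
  have key := (hasDerivAt_integral_of_dominated_loc_of_deriv_le (μ := gaussianTriple)
    (F := rotProd g g) (F' := F') (x₀ := θ) Filter.univ_mem
    (bound := fun p ↦ (‖p.1‖ + ‖p.2.1‖) * C₁ + (‖p.1‖ + ‖p.2.2‖) * C₂)
    (.of_forall fun t ↦ (continuous_rotProd hg hg t).aestronglyMeasurable)
    (integrable_rotProd hg hg θ)
    (by
      have := continuous_rotProd hg' hg θ
      have := continuous_rotProd hg hg' θ
      exact Continuous.aestronglyMeasurable (by fun_prop))
    (.of_forall fun p t _ ↦ by
      refine norm_add_le_of_le ?_ ?_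
      · rw [norm_mul]
        exact mul_le_mul (hlin _ _ _) (hC₁ t p) (norm_nonneg _) (by positivity)
      · rw [norm_mul]
        exact mul_le_mul (hlin _ _ _) (hC₂ t p) (norm_nonneg _) (by positivity))
    (((i1.norm.add i2.norm).mul_const C₁).add ((i1.norm.add i3.norm).mul_const C₂))
    (.of_forall fun p t _ ↦ by
      have hl : ∀ y : ℝ, HasDerivAt (fun t ↦ cos t * p.1 + sin t * y)
          (-sin t * p.1 + cos t * y) t := fun y ↦
        ((hasDerivAt_cos t).mul_const p.1).add ((hasDerivAt_sin t).mul_const y)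
      convert! ((hg.hasDerivAt _).comp t (hl p.2.1)).mul ((hg.hasDerivAt _).comp t (hl p.2.2))
        using 1
      simp only [F', rotProd, Function.comp]
      ring)).2
  convert! key using 1
  have e : ∀ p, F' θ p = -sin θ * (p.1 * rotProd (deriv g) g θ p + p.1 * rotProd g (deriv g) θ p)
      + cos θ * (p.2.1 * rotProd (deriv g) g θ p + p.2.2 * rotProd g (deriv g) θ p) :=
    fun p ↦ by simp only [F']; ring
  have j1 := integrable_mul_rotProd i1 hg' hg θ
  have j2 := integrable_mul_rotProd i1 hg hg' θ
  have j3 := integrable_mul_rotProd i2 hg' hg θ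
  have j4 := integrable_mul_rotProd i3 hg hg' θ
  simp_rw [e]
  rw [integral_add (by fun_prop) (by fun_prop), integral_const_mul,
    integral_const_mul, integral_add j1 j2, integral_add j3 j4, integral_fst_mul_rotProd hg' hg,
    integral_fst_mul_rotProd hg hg', integral_snd_fst_mul_rotProd hg' hg,
    integral_snd_snd_mul_rotProd hg hg', rotEnergy]
  ring

/-- The alternating Taylor remainder of the rotation energy, in the variable `sin² θ`. -/
noncomputable def rotRemainder (m : ℕ) (g : ℝ → ℝ) (θ : ℝ) : ℝ :=
  ∑ k ∈ Finset.range (m + 1),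
    (-1 : ℝ) ^ k / (Nat.factorial k) * (sin θ ^ 2) ^ k * rotEnergy (iteratedDeriv k g) 0
    - rotEnergy g θ

lemma hasDerivAt_rotRemainder_zero (hg : IsTestFunction g) (θ : ℝ) :
    HasDerivAt (rotRemainder 0 g) (2 * sin θ * cos θ * rotEnergy (deriv g) θ) θ := by
  have := (hasDerivAt_rotEnergy hg θ).const_sub (rotEnergy g 0)
  rw [neg_neg] at this
  convert! this using 1
  ext t
  simp [rotRemainder]

lemma hasDerivAt_rotRemainder_succ (hg : IsTestFunction g) (m : ℕ) (θ : ℝ) :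
    HasDerivAt (rotRemainder (m + 1) g)
      (-(2 * sin θ * cos θ * rotRemainder m (deriv g) θ)) θ := by
  have hs : HasDerivAt (fun t ↦ sin t ^ 2) (2 * sin θ * cos θ) θ := by
    simpa using! (hasDerivAt_sin θ).pow 2
  have hsum := HasDerivAt.fun_sum (u := Finset.range (m + 2)) (fun k _ ↦
    ((hs.pow k).const_mul ((-1 : ℝ) ^ k / (Nat.factorial k))).mul_const
      (rotEnergy (iteratedDeriv k g) 0))
  convert! hsum.sub (hasDerivAt_rotEnergy hg θ) using 1
  have e : ∀ k : ℕ, (-1 : ℝ) ^ (k + 1) / ((k + 1).factorial : ℝ) *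
      (((k + 1 : ℕ) : ℝ) * (sin θ ^ 2) ^ (k + 1 - 1) * (2 * sin θ * cos θ)) *
        rotEnergy (iteratedDeriv (k + 1) g) 0 = -(2 * sin θ * cos θ) *
      ((-1 : ℝ) ^ k / (k.factorial : ℝ) * (sin θ ^ 2) ^ k *
        rotEnergy (iteratedDeriv k (deriv g)) 0) := fun k ↦ by
    rw [iteratedDeriv_succ', Nat.factorial_succ, Nat.add_sub_cancel]
    have : (Nat.factorial k : ℝ) ≠ 0 := by positivity
    push_cast
    field_simp
    ring
  rw [Finset.sum_range_succ', rotRemainder]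
  simp_rw [e]
  rw [← Finset.mul_sum]
  simp only [Nat.cast_zero, zero_mul, mul_zero, add_zero]
  ring

lemma rotRemainder_at_zero (m : ℕ) (g : ℝ → ℝ) : rotRemainder m g 0 = 0 := by
  rw [rotRemainder, Finset.sum_range_succ']
  simp

lemma nonneg_of_hasDerivAt_nonneg {R R' : ℝ → ℝ} {b : ℝ} (hd : ∀ t, HasDerivAt R (R' t) t)
    (h₀ : R 0 = 0) (hR' : ∀ t ∈ Set.Icc 0 b, 0 ≤ R' t) {t : ℝ} (ht : t ∈ Set.Icc 0 b) :
    0 ≤ R t := by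
  have hmono : MonotoneOn R (Set.Icc 0 b) :=
    monotoneOn_of_deriv_nonneg (convex_Icc 0 b) (fun x _ ↦ (hd x).continuousAt.continuousWithinAt)
      (fun x _ ↦ (hd x).differentiableAt.differentiableWithinAt)
      (fun x hx ↦ (hd x).deriv ▸ hR' x (interior_subset hx))
  exact h₀ ▸ hmono ⟨le_rfl, ht.1.trans ht.2⟩ ht ht.1

lemma neg_one_pow_mul_rotRemainder_nonneg (m : ℕ) (hg : IsTestFunction g) {θ : ℝ}
    (hθ : θ ∈ Set.Icc 0 (π / 2)) : 0 ≤ (-1) ^ m * rotRemainder m g θ := by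
  have hsc : ∀ t ∈ Set.Icc 0 (π / 2), 0 ≤ 2 * sin t * cos t := fun t ht ↦
    mul_nonneg (mul_nonneg zero_le_two
      (sin_nonneg_of_nonneg_of_le_pi ht.1 (by linarith [ht.2, pi_pos])))
      (cos_nonneg_of_neg_pi_div_two_le_of_le (by linarith [ht.1, pi_pos]) ht.2)
  induction m generalizing g θ with
  | zero =>
    refine nonneg_of_hasDerivAt_nonneg
      (fun t ↦ (hasDerivAt_rotRemainder_zero hg t).const_mul ((-1) ^ 0))
      (by simp [rotRemainder_at_zero]) (fun t ht ↦ ?_) hθ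
    simpa using mul_nonneg (hsc t ht) (rotEnergy_nonneg hg.deriv t)
  | succ m ih =>
    refine nonneg_of_hasDerivAt_nonneg
      (fun t ↦ (hasDerivAt_rotRemainder_succ hg m t).const_mul ((-1) ^ (m + 1)))
      (by simp [rotRemainder_at_zero]) (fun t ht ↦ ?_) hθ
    have := mul_nonneg (hsc t ht) (ih hg.deriv ht)
    convert! this using 1
    ring

end RotEnergy

/-- Houdré–Kagan upper bound in dimension one (even `m`): for the
standard Gaussian measure `γ` on `ℝ` and smooth compactly supported `f`,
`∫ Σ_{k=0}^{m} ((−1)^k/k!) (f^{(k)})² dγ ≥ (∫ f dγ)²`. -/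
theorem stmt_17 (m : ℕ) (heven : Even m) (hpos : 0 < m)
    (f : ℝ → ℝ) (hf : ContDiff ℝ (⊤ : ℕ∞) f) (hsupp : HasCompactSupport f) :
    ∫ x, (∑ k ∈ Finset.range (m + 1),
        (-1 : ℝ) ^ k / (Nat.factorial k) * (iteratedDeriv k f x) ^ 2)
        ∂(gaussianReal 0 1)
      ≥ (∫ x, f x ∂(gaussianReal 0 1)) ^ 2 := by
  have ht : IsTestFunction f := ⟨hf, hsupp⟩
  have key := neg_one_pow_mul_rotRemainder_nonneg m ht (θ := π / 2) ⟨by positivity, le_rfl⟩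
  rw [heven.neg_one_pow, one_mul, rotRemainder, rotEnergy_pi_div_two ht, sub_nonneg] at key
  refine key.trans_eq ?_
  have hi : ∀ k, Integrable (fun x ↦ iteratedDeriv k f x ^ 2) (gaussianReal 0 1) := fun k ↦ by
    obtain ⟨C, -, hC⟩ := (ht.iteratedDeriv k).exists_bound
    refine .of_bound ((ht.iteratedDeriv k).continuous.pow 2).aestronglyMeasurable (C ^ 2)
      (.of_forall fun x ↦ ?_)
    rw [norm_pow]
    gcongr
    exact hC x
  rw [integral_finsetSum _ fun k _ ↦ (hi k).const_mul _]
  refine Finset.sum_congr rfl fun k _ ↦ ?_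
  rw [integral_const_mul, rotEnergy_zero (ht.iteratedDeriv k), sin_pi_div_two]
  simp
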